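/- Let D = (V, A) be a digraph and suppose for every subpartition {X₁, …, X_t} of V we have ∑_{j=1}^t d_A^-(X_j) ≥ k(t−1). Then D contains k arc-disjoint spanning arborescences (with arbitrary, possibly different, roots). -/

import Mathlib

open scoped Classical

/-- The in-degree `d_A^-(X)`: the number of arcs of the multiset `A` with head
in `X` and tail outside `X`. -/
def dIn {V : Type*} [DecidableEq V] (A : Multiset (V × V)) (X : Finset V) : ℕ :=
  (A.filter (fun a => a.2 ∈ X ∧ a.1 ∉ X)).card

/-- `B` is a spanning `r`-arborescence on the vertex type `V`: every vertex is
reachable from `r`, no arc enters `r`, and every other vertex has exactly one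
entering arc. -/
def IsSpanningArborescence {V : Type*} [DecidableEq V]
    (r : V) (B : Multiset (V × V)) : Prop :=
  (∀ v : V, Relation.ReflTransGen (fun a b : V => (a, b) ∈ B) r v) ∧
  (∀ p ∈ B, p.2 ≠ r) ∧
  (∀ v : V, v ≠ r → (B.filter (fun p => p.2 = v)).card = 1)

/-- `P` is a subpartition of the vertex set: a family of pairwise disjoint
nonempty subsets. -/
def IsSubpartition {V : Type*} [DecidableEq V] (P : Finset (Finset V)) : Prop :=
  (∀ X ∈ P, X.Nonempty) ∧ (P : Set (Finset V)).Pairwise Disjoint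

section helpers

variable {V : Type*} [DecidableEq V]

lemma dIn_cons (a : V × V) (A : Multiset (V × V)) (X : Finset V) :
    dIn (a ::ₘ A) X = dIn A X + if (a.2 ∈ X ∧ a.1 ∉ X) then 1 else 0 := by
  unfold dIn
  rw [Multiset.filter_cons]
  split_ifs <;> simp [add_comm]

lemma dIn_zero (X : Finset V) : dIn (0 : Multiset (V × V)) X = 0 := by
  simp [dIn]

lemma dIn_submod (A : Multiset (V × V)) (X Y : Finset V) :
    dIn A (X ∩ Y) + dIn A (X ∪ Y) ≤ dIn A X + dIn A Y := by
  induction A using Multiset.induction_on with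
  | empty => simp [dIn_zero]
  | cons a A ih =>
    simp only [dIn_cons, Finset.mem_inter, Finset.mem_union]
    by_cases h1 : a.1 ∈ X <;> by_cases h2 : a.1 ∈ Y <;> by_cases h3 : a.2 ∈ X <;>
      by_cases h4 : a.2 ∈ Y <;> simp [h1, h2, h3, h4] <;> omega

lemma dIn_univ [Fintype V] (A : Multiset (V × V)) : dIn A Finset.univ = 0 := by
  simp [dIn]

/-- If more arcs enter `X \ R` than `X`, some arc goes from `X ∩ R` to `X \ R`. -/
lemma exists_arc (A : Multiset (V × V)) (X R : Finset V)
    (h : dIn A X < dIn A (X \ R)) :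
    ∃ a ∈ A, a.1 ∈ X ∧ a.1 ∈ R ∧ a.2 ∈ X ∧ a.2 ∉ R := by
  by_contra hcon
  push Not at hcon
  refine absurd h (not_lt.mpr ?_)
  unfold dIn
  apply Multiset.card_le_card
  rw [Multiset.le_filter]
  refine ⟨Multiset.filter_le _ _, fun a ha => ?_⟩
  rw [Multiset.mem_filter, Finset.mem_sdiff, Finset.mem_sdiff] at ha
  have := hcon a
  tauto

/-- number of root sets missed by `X` -/
def pMiss {ι : Type*} [Fintype ι] (R : ι → Finset V) (X : Finset V) : ℕ :=
  ∑ j, if Disjoint (R j) X then 1 else 0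

lemma pMiss_supermod {ι : Type*} [Fintype ι] (R : ι → Finset V) (X Y : Finset V) :
    pMiss R X + pMiss R Y ≤ pMiss R (X ∩ Y) + pMiss R (X ∪ Y) := by
  unfold pMiss
  rw [← Finset.sum_add_distrib, ← Finset.sum_add_distrib]
  apply Finset.sum_le_sum
  intro j _
  have h1 : Disjoint (R j) X → Disjoint (R j) (X ∩ Y) :=
    fun h => h.mono_right Finset.inter_subset_left
  have h2 : Disjoint (R j) Y → Disjoint (R j) (X ∩ Y) :=
    fun h => h.mono_right Finset.inter_subset_right
  simp only [Finset.disjoint_union_right]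
  split_ifs <;> first | omega | tauto

lemma pMiss_supermod_strict {ι : Type*} [Fintype ι] (R : ι → Finset V) (X Y : Finset V)
    (i : ι) (hX : ¬ Disjoint (R i) X) (hY : ¬ Disjoint (R i) Y)
    (hXY : Disjoint (R i) (X ∩ Y)) :
    pMiss R X + pMiss R Y < pMiss R (X ∩ Y) + pMiss R (X ∪ Y) := by
  unfold pMiss
  rw [← Finset.sum_add_distrib, ← Finset.sum_add_distrib]
  apply Finset.sum_lt_sum
  · intro j _
    have h1 : Disjoint (R j) X → Disjoint (R j) (X ∩ Y) :=
      fun h => h.mono_right Finset.inter_subset_left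
    have h2 : Disjoint (R j) Y → Disjoint (R j) (X ∩ Y) :=
      fun h => h.mono_right Finset.inter_subset_right
    simp only [Finset.disjoint_union_right]
    split_ifs <;> first | omega | tauto
  · refine ⟨i, Finset.mem_univ _, ?_⟩
    simp only [Finset.disjoint_union_right]
    simp [hX, hY, hXY]

lemma pMiss_lt {ι : Type*} [Fintype ι] (R : ι → Finset V) (X : Finset V) (i : ι)
    (hX : ¬ Disjoint (R i) X) : pMiss R X < pMiss R (X \ R i) := by
  unfold pMiss
  apply Finset.sum_lt_sum
  · intro j _
    have h1 : Disjoint (R j) X → Disjoint (R j) (X \ R i) :=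
      fun h => h.mono_right Finset.sdiff_subset
    split_ifs <;> first | omega | tauto
  · refine ⟨i, Finset.mem_univ _, ?_⟩
    have : Disjoint (R i) (X \ R i) := Finset.disjoint_sdiff
    simp [hX, this]

/-- spanning branching with root set `R` -/
def IsBranching (R : Finset V) (B : Multiset (V × V)) : Prop :=
  (∀ v : V, ∃ r ∈ R, Relation.ReflTransGen (fun a b : V => (a, b) ∈ B) r v) ∧
  (∀ p ∈ B, p.2 ∉ R) ∧
  (∀ v : V, v ∉ R → (B.filter (fun p => p.2 = v)).card = 1)

lemma IsBranching.cons {R : Finset V} {B : Multiset (V × V)} {u v : V} (hu : u ∈ R)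
    (hv : v ∉ R) (h : IsBranching (insert v R) B) : IsBranching R ((u, v) ::ₘ B) := by
  obtain ⟨h1, h2, h3⟩ := h
  refine ⟨?_, ?_, ?_⟩
  · intro w
    obtain ⟨r, hr, hw⟩ := h1 w
    have hw' : Relation.ReflTransGen (fun a b : V => (a, b) ∈ (u, v) ::ₘ B) r w :=
      Relation.ReflTransGen.mono (fun a b hab => Multiset.mem_cons_of_mem hab) _ _ hw
    rcases Finset.mem_insert.mp hr with rfl | hr
    · exact ⟨u, hu, Relation.ReflTransGen.head (Multiset.mem_cons_self _ _) hw'⟩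
    · exact ⟨r, hr, hw'⟩
  · intro p hp
    rcases Multiset.mem_cons.mp hp with rfl | hp
    · exact hv
    · exact fun hh => h2 p hp (Finset.mem_insert_of_mem hh)
  · intro w hw
    rw [Multiset.filter_cons]
    by_cases hvw : v = w
    · subst hvw
      have : B.filter (fun p => p.2 = v) = 0 := by
        rw [Multiset.filter_eq_nil]
        intro p hp hpv
        exact h2 p hp (by simp [hpv])
      simp [this]
    · have := h3 w (by simp [hw, Ne.symm hvw])
      simpa [hvw] using this

/-- Edmonds' disjoint branchings theorem. -/
lemma edmonds [Fintype V] {ι : Type*} [Fintype ι] (n : ℕ) :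
    ∀ (A : Multiset (V × V)) (R : ι → Finset V), (∑ j, (R j)ᶜ.card) = n →
      (∀ j, (R j).Nonempty) →
      (∀ X : Finset V, X.Nonempty → pMiss R X ≤ dIn A X) →
      ∃ B : ι → Multiset (V × V), (∑ j, B j) ≤ A ∧ ∀ j, IsBranching (R j) (B j) := by
  induction n with
  | zero =>
    intro A R hn hR hc
    refine ⟨fun _ => 0, by simp, ?_⟩
    intro j
    have hj : R j = Finset.univ := by
      rw [Finset.sum_eq_zero_iff] at hn
      simpa using hn j (Finset.mem_univ _)
    refine ⟨fun v => ⟨v, by simp [hj], Relation.ReflTransGen.refl⟩, by simp, by simp [hj]⟩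
  | succ n ih =>
    intro A R hn hR hc
    obtain ⟨i, hi⟩ : ∃ i, (R i)ᶜ.Nonempty := by
      by_contra hcon
      push Not at hcon
      simp [hcon] at hn
    let S : Set (Finset V) := {X | dIn A X = pMiss R X ∧ ¬ Disjoint (R i) X ∧ (X \ R i).Nonempty}
    have hS : Finset.univ ∈ S := by
      refine ⟨?_, ?_, ?_⟩
      · rw [dIn_univ]
        symm
        unfold pMiss
        rw [Finset.sum_eq_zero_iff]
        intro j _
        have := hR j
        rw [if_neg]
        rw [Finset.disjoint_left]
        push Not
        obtain ⟨x, hx⟩ := this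
        exact ⟨x, hx, Finset.mem_univ _⟩
      · rw [Finset.disjoint_left]
        push Not
        obtain ⟨x, hx⟩ := hR i
        exact ⟨x, hx, Finset.mem_univ _⟩
      · rwa [← Finset.compl_eq_univ_sdiff]
    obtain ⟨X, -, hX⟩ := (Set.toFinite S).exists_le_minimal hS
    obtain ⟨⟨hXt, hXi, hXd⟩, hmin⟩ := hX
    obtain ⟨⟨u, v⟩, ha, huX, huR, hvX, hvR⟩ := exists_arc A X (R i) (by
      rw [hXt]
      exact (pMiss_lt R X i hXi).trans_le (hc _ hXd))
    simp only at huX huR hvX hvR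
    obtain ⟨A', rfl⟩ := Multiset.exists_cons_of_mem ha
    let R' : ι → Finset V := Function.update R i (insert v (R i))
    have hR'i : R' i = insert v (R i) := by simp [R']
    have hR'j : ∀ j, j ≠ i → R' j = R j := fun j hj => by simp [R', hj]
    have hsub : ∀ j, R j ⊆ R' j := by
      intro j
      by_cases hj : j = i
      · subst hj; rw [hR'i]; exact Finset.subset_insert _ _
      · rw [hR'j j hj]
    have hple : ∀ Y, pMiss R' Y ≤ pMiss R Y := by
      intro Y
      unfold pMiss
      apply Finset.sum_le_sum
      intro j _
      have : Disjoint (R' j) Y → Disjoint (R j) Y := fun h => h.mono_left (hsub j)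
      split_ifs <;> first | omega | tauto
    obtain ⟨B, hB, hBr⟩ := ih A' R' (by
        have e1 := Finset.add_sum_erase Finset.univ (fun j => (R j)ᶜ.card) (Finset.mem_univ i)
        have e2 := Finset.add_sum_erase Finset.univ (fun j => (R' j)ᶜ.card) (Finset.mem_univ i)
        have e3 : ∑ j ∈ Finset.univ.erase i, (R' j)ᶜ.card =
            ∑ j ∈ Finset.univ.erase i, (R j)ᶜ.card :=
          Finset.sum_congr rfl fun j hj => by rw [hR'j j (Finset.ne_of_mem_erase hj)]
        have e4 : (R' i)ᶜ.card + 1 = (R i)ᶜ.card := by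
          rw [hR'i, Finset.compl_insert]
          exact Finset.card_erase_add_one (by simpa using hvR)
        omega)
      (fun j => (hR j).mono (hsub j))
      (by
        intro Y hY
        have h1 := hc Y hY
        rw [dIn_cons] at h1
        simp only at h1
        have h2 := hple Y
        split_ifs at h1 with hent
        · obtain ⟨hvY, huY⟩ := hent
          by_cases hdisj : Disjoint (R i) Y
          · have : pMiss R' Y < pMiss R Y := by
              unfold pMiss
              apply Finset.sum_lt_sum
              · intro j _
                have : Disjoint (R' j) Y → Disjoint (R j) Y := fun h => h.mono_left (hsub j)
                split_ifs <;> first | omega | tauto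
              · refine ⟨i, Finset.mem_univ _, ?_⟩
                rw [hR'i, if_pos hdisj, if_neg]
                · exact one_pos
                · rw [Finset.disjoint_left]
                  push Not
                  exact ⟨v, by simp, hvY⟩
            omega
          · by_contra hlt
            have hYt : dIn ((u, v) ::ₘ A') Y = pMiss R Y := by
              rw [dIn_cons, if_pos ⟨hvY, huY⟩]
              omega
            have hvXY : v ∈ X ∩ Y := Finset.mem_inter.mpr ⟨hvX, hvY⟩
            have s1 := dIn_submod ((u, v) ::ₘ A') X Y
            have s2 := hc (X ∩ Y) ⟨v, hvXY⟩
            have s3 := hc (X ∪ Y) ⟨v, Finset.mem_union_left _ hvX⟩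
            have s4 := pMiss_supermod R X Y
            have hmem : X ∩ Y ∈ S := by
              refine ⟨by omega, ?_, ⟨v, Finset.mem_sdiff.mpr ⟨hvXY, hvR⟩⟩⟩
              intro hd
              have s5 := pMiss_supermod_strict R X Y i hXi hdisj hd
              omega
            have := hmin hmem Finset.inter_subset_left huX
            exact huY (Finset.mem_inter.mp this).2
        · omega)
    refine ⟨Function.update B i ((u, v) ::ₘ B i), ?_, ?_⟩
    · have e1 := Finset.add_sum_erase Finset.univ B (Finset.mem_univ i)
      have e2 := Finset.add_sum_erase Finset.univ (Function.update B i ((u, v) ::ₘ B i))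
        (Finset.mem_univ i)
      have e3 : ∑ j ∈ Finset.univ.erase i, Function.update B i ((u, v) ::ₘ B i) j =
          ∑ j ∈ Finset.univ.erase i, B j :=
        Finset.sum_congr rfl fun j hj => by simp [Finset.ne_of_mem_erase hj]
      rw [← e2, e3, Function.update_self, Multiset.cons_add, e1]
      exact Multiset.cons_le_cons _ hB
    · intro j
      by_cases hj : j = i
      · subst hj
        rw [Function.update_self]
        apply IsBranching.cons huR hvR
        rw [← hR'i]
        exact hBr j
      · rw [Function.update_of_ne hj, ← hR'j j hj]
        exact hBr j

lemma countP_submod (M : Multiset V) (X Y : Finset V) :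
    M.countP (· ∈ X ∩ Y) + M.countP (· ∈ X ∪ Y) = M.countP (· ∈ X) + M.countP (· ∈ Y) := by
  induction M using Multiset.induction_on with
  | empty => simp
  | cons a A ih =>
    simp only [Multiset.countP_cons, Finset.mem_inter, Finset.mem_union] at ih ⊢
    by_cases h1 : a ∈ X <;> by_cases h2 : a ∈ Y <;> simp [h1, h2] <;> omega

lemma card_le_sum_countP (M : Multiset V) (P : Finset (Finset V))
    (h : ∀ v ∈ M, ∃ X ∈ P, v ∈ X) : M.card ≤ ∑ X ∈ P, M.countP (· ∈ X) := by
  induction M using Multiset.induction_on with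
  | empty => simp
  | cons a M ih =>
    have h1 := ih fun v hv => h v (Multiset.mem_cons_of_mem hv)
    obtain ⟨X, hX, haX⟩ := h a (Multiset.mem_cons_self _ _)
    simp only [Multiset.countP_cons, Multiset.card_cons, Finset.sum_add_distrib]
    have : 1 ≤ ∑ X ∈ P, (if a ∈ X then 1 else 0) := by
      refine le_trans ?_ (Finset.single_le_sum (fun _ _ => Nat.zero_le _) hX)
      simp [haX]
    omega

/-- Frank's choice of the roots. -/
lemma exists_roots [Fintype V] [Nonempty V] (A : Multiset (V × V)) (k : ℕ)
    (hcut : ∀ P : Finset (Finset V), IsSubpartition P →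
      (∑ X ∈ P, (dIn A X : ℤ)) ≥ (k : ℤ) * ((P.card : ℤ) - 1)) :
    ∃ M : Multiset V, M.card = k ∧
      ∀ X : Finset V, X.Nonempty → k ≤ M.countP (· ∈ X) + dIn A X := by
  let good : Multiset V → Prop := fun M =>
    ∀ X : Finset V, X.Nonempty → k ≤ M.countP (· ∈ X) + dIn A X
  have hex : ∃ n, ∃ M, good M ∧ M.card = n := by
    refine ⟨_, k • (Finset.univ : Finset V).val, ?_, rfl⟩
    rintro X ⟨x, hx⟩
    rw [Multiset.countP_nsmul]
    have : 0 < Multiset.countP (· ∈ X) (Finset.univ : Finset V).val :=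
      Multiset.countP_pos.mpr ⟨x, Finset.mem_univ _, hx⟩
    have := Nat.le_mul_of_pos_right k this
    omega
  obtain ⟨M, hM, hMn⟩ := Nat.find_spec hex
  have hmin : ∀ M', good M' → M.card ≤ M'.card := by
    intro M' h'
    rw [hMn]
    exact Nat.find_min' hex ⟨M', h', rfl⟩
  refine ⟨M, le_antisymm ?_ ?_, hM⟩
  swap
  · have := hM Finset.univ Finset.univ_nonempty
    rw [dIn_univ] at this
    exact this.trans (by simpa using Multiset.countP_le_card _ _)
  let T : Set (Finset V) := {X | X.Nonempty ∧ M.countP (· ∈ X) + dIn A X = k}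
  have htight : ∀ v ∈ M, ∃ X ∈ T, v ∈ X := by
    intro v hv
    by_contra hcon
    push Not at hcon
    obtain ⟨M', rfl⟩ := Multiset.exists_cons_of_mem hv
    have : good M' := by
      intro X hX
      have h1 := hM X hX
      have h2 := hcon X
      rw [Multiset.countP_cons] at h1
      split_ifs at h1 with hvX
      · by_contra hlt
        refine h2 ⟨hX, ?_⟩ hvX
        rw [Multiset.countP_cons, if_pos hvX]
        omega
      · omega
    have := hmin M' this
    simp at this
  let P : Finset (Finset V) := Finset.univ.filter (fun X => Maximal (· ∈ T) X)
  have hP : ∀ X, X ∈ P ↔ Maximal (· ∈ T) X := fun X => by simp [P]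
  have hsp : IsSubpartition P := by
    refine ⟨fun X hX => ((hP X).mp hX).1.1, ?_⟩
    intro X hX Y hY hne
    have hX := (hP X).mp hX
    have hY := (hP Y).mp hY
    by_contra hd
    rw [Finset.disjoint_iff_inter_eq_empty, ← ne_eq, ← Finset.nonempty_iff_ne_empty] at hd
    have hun : (X ∪ Y).Nonempty := hX.1.1.mono Finset.subset_union_left
    have s1 := hM _ hd
    have s2 := hM _ hun
    have s3 := countP_submod M X Y
    have s4 := dIn_submod A X Y
    have s5 := hX.1.2
    have s6 := hY.1.2
    have hU : X ∪ Y ∈ T := ⟨hun, by omega⟩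
    have e1 := hX.2 hU Finset.subset_union_left
    have e2 := hY.2 hU Finset.subset_union_right
    exact hne (le_antisymm (Finset.subset_union_left.trans e2)
      (Finset.subset_union_right.trans e1))
  have h1 := card_le_sum_countP M P (by
    intro v hv
    obtain ⟨X, hX, hvX⟩ := htight v hv
    obtain ⟨Y, hXY, hY⟩ := (Set.toFinite T).exists_le_maximal hX
    exact ⟨Y, (hP Y).mpr hY, hXY hvX⟩)
  have h2 := hcut P hsp
  have h3 : ∑ X ∈ P, (M.countP (· ∈ X) + dIn A X) = P.card * k := by
    rw [Finset.sum_congr rfl (fun X hX => ((hP X).mp hX).1.2)]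
    simp
  rw [Finset.sum_add_distrib] at h3
  zify at h1 h3 ⊢
  linarith

end helpers

/-- If every subpartition `{X₁, …, X_t}` of the vertex set of a digraph
`D = (V, A)` satisfies `∑_{j=1}^t d_A^-(X_j) ≥ k(t-1)`, then `D` contains `k`
arc-disjoint spanning arborescences (with arbitrary, possibly different,
roots). -/
theorem arborescence_packing_arbitrary_roots
    {V : Type*} [Fintype V] [DecidableEq V] [Nonempty V]
    (A : Multiset (V × V)) (hA : ∀ p ∈ A, p.1 ≠ p.2) (k : ℕ)
    (hcut : ∀ P : Finset (Finset V), IsSubpartition P →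
      (∑ X ∈ P, (dIn A X : ℤ)) ≥ (k : ℤ) * ((P.card : ℤ) - 1)) :
    ∃ (r : Fin k → V) (B : Fin k → Multiset (V × V)),
      (∑ i, B i) ≤ A ∧ ∀ i, IsSpanningArborescence (r i) (B i) := by
  obtain ⟨M, hMk, hM⟩ := exists_roots A k hcut
  obtain ⟨r, hr⟩ : ∃ r : Fin k → V, Multiset.map r Finset.univ.val = M := by
    induction M using Quot.inductionOn with
    | _ l =>
      have hl : l.length = k := by simpa using hMk
      subst hl
      refine ⟨l.get, ?_⟩
      simp [Fin.univ_def, Fin.univ_val_map]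
  obtain ⟨B, hB, hBr⟩ := edmonds _ A (fun j => {r j}) rfl (by simp) (by
    intro X hX
    have h := hM X hX
    rw [← hr, Multiset.countP_map] at h
    have e : pMiss (fun j => ({r j} : Finset V)) X +
        (Multiset.filter (fun j => r j ∈ X) Finset.univ.val).card = k := by
      have h1 : (Multiset.filter (fun j => r j ∈ X) Finset.univ.val).card =
          (Finset.univ.filter (fun j => r j ∈ X)).card := rfl
      rw [h1, Finset.card_filter]
      unfold pMiss
      rw [← Finset.sum_add_distrib]
      rw [Finset.sum_congr rfl (g := fun _ => 1)]
      · simp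
      · intro j _
        by_cases hj : r j ∈ X <;> simp [hj]
    omega)
  refine ⟨r, B, hB, fun i => ?_⟩
  obtain ⟨h1, h2, h3⟩ := hBr i
  refine ⟨fun v => ?_, fun p hp => by simpa using h2 p hp, fun v hv => h3 v (by simpa using hv)⟩
  obtain ⟨s, hs, h⟩ := h1 v
  rw [Finset.mem_singleton] at hs
  rwa [hs] at h
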